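/- Let a < b be real numbers, λ ∈ [0,1], and let f : [a,b] → ℝ be continuous on [a,b] and differentiable on (a,b) with |f'(s)| ≤ M for all s ∈ (a,b). Then |(1−λ)·f((a+b)/2) + λ·(f(a)+f(b))/2 − (1/(b−a))·∫_a^b f(s) ds| ≤ M·(b−a)·((1−λ)² + λ²)/4. -/

import Mathlib

/-- The mean value inequality on a closed interval, for a function differentiable in its interior. -/
theorem abs_sub_le_of_abs_hasDerivAt_le {a b M : ℝ} {f f' : ℝ → ℝ}
    (hcont : ContinuousOn f (Set.Icc a b))
    (hderiv : ∀ s ∈ Set.Ioo a b, HasDerivAt f (f' s) s)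
    (hbound : ∀ s ∈ Set.Ioo a b, |f' s| ≤ M) {x y : ℝ}
    (hx : x ∈ Set.Icc a b) (hy : y ∈ Set.Icc a b) : |f x - f y| ≤ M * |x - y| := by
  wlog hxy : x ≤ y generalizing x y
  · rw [abs_sub_comm, abs_sub_comm x]
    exact this hy hx (le_of_not_ge hxy)
  rcases hxy.eq_or_lt with rfl | hlt
  · simp
  obtain ⟨c, hc, hslope⟩ := exists_hasDerivAt_eq_slope f f' hlt
    (hcont.mono (Set.Icc_subset_Icc hx.1 hy.2))
    fun s hs => hderiv s (Set.Ioo_subset_Ioo hx.1 hy.2 hs)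
  have hpos : 0 < y - x := sub_pos.2 hlt
  have heq : f y - f x = f' c * (y - x) := by
    rw [hslope, div_mul_cancel₀ _ hpos.ne']
  rw [abs_sub_comm, heq, abs_mul, abs_sub_comm x]
  exact mul_le_mul_of_nonneg_right (hbound c (Set.Ioo_subset_Ioo hx.1 hy.2 hc)) (abs_nonneg _)

/-- Ostrowski's inequality at `c`, for a function satisfying a Lipschitz bound at `c`. -/
theorem abs_integral_sub_mul_le {u v c M : ℝ} {f : ℝ → ℝ} (huc : u ≤ c) (hcv : c ≤ v)
    (hcont : ContinuousOn f (Set.Icc u v))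
    (hlip : ∀ s ∈ Set.Icc u v, |f s - f c| ≤ M * |s - c|) :
    |(∫ s in u..v, f s) - f c * (v - u)| ≤ M * ((c - u) ^ 2 + (v - c) ^ 2) / 2 := by
  have hint₁ : IntervalIntegrable f MeasureTheory.volume u c :=
    (hcont.mono (Set.Icc_subset_Icc_right hcv)).intervalIntegrable_of_Icc huc
  have hint₂ : IntervalIntegrable f MeasureTheory.volume c v :=
    (hcont.mono (Set.Icc_subset_Icc_left huc)).intervalIntegrable_of_Icc hcv
  have hleft : |∫ s in u..c, (f s - f c)| ≤ ∫ s in u..c, M * (c - s) := by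
    rw [← Real.norm_eq_abs]
    refine intervalIntegral.norm_integral_le_of_norm_le huc (.of_forall fun s hs => ?_)
      (Continuous.intervalIntegrable (by fun_prop) _ _)
    have h := hlip s ⟨hs.1.le, hs.2.trans hcv⟩
    rwa [abs_sub_comm s, abs_of_nonneg (sub_nonneg.2 hs.2)] at h
  have hright : |∫ s in c..v, (f s - f c)| ≤ ∫ s in c..v, M * (s - c) := by
    rw [← Real.norm_eq_abs]
    refine intervalIntegral.norm_integral_le_of_norm_le hcv (.of_forall fun s hs => ?_)
      (Continuous.intervalIntegrable (by fun_prop) _ _)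
    have h := hlip s ⟨huc.trans hs.1.le, hs.2⟩
    rwa [abs_of_nonneg (sub_nonneg.2 hs.1.le)] at h
  have hleft_eq : ∫ s in u..c, M * (c - s) = M * (c - u) ^ 2 / 2 := by
    rw [intervalIntegral.integral_const_mul, intervalIntegral.integral_sub (by simp) (by simp)]
    simp only [intervalIntegral.integral_const, integral_id, smul_eq_mul]
    ring
  have hright_eq : ∫ s in c..v, M * (s - c) = M * (v - c) ^ 2 / 2 := by
    rw [intervalIntegral.integral_const_mul, intervalIntegral.integral_sub (by simp) (by simp)]
    simp only [intervalIntegral.integral_const, integral_id, smul_eq_mul]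
    ring
  rw [hleft_eq, intervalIntegral.integral_sub hint₁ (by simp),
    intervalIntegral.integral_const, smul_eq_mul, abs_le] at hleft
  rw [hright_eq, intervalIntegral.integral_sub hint₂ (by simp),
    intervalIntegral.integral_const, smul_eq_mul, abs_le] at hright
  rw [← intervalIntegral.integral_add_adjacent_intervals hint₁ hint₂, abs_le]
  constructor <;> linarith [hleft.1, hleft.2, hright.1, hright.2]

/-- One-parameter family of quadrature inequalities at the midpoint. -/
theorem midpoint_quadrature_family_inequality (a b l M : ℝ) (hab : a < b)
    (hl : l ∈ Set.Icc (0 : ℝ) 1) (f f' : ℝ → ℝ)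
    (hcont : ContinuousOn f (Set.Icc a b))
    (hderiv : ∀ s ∈ Set.Ioo a b, HasDerivAt f (f' s) s)
    (hbound : ∀ s ∈ Set.Ioo a b, |f' s| ≤ M) :
    |(1 - l) * f ((a + b) / 2) + l * (f a + f b) / 2 -
        (1 / (b - a)) * ∫ s in a..b, f s| ≤
      M * (b - a) * ((1 - l) ^ 2 + l ^ 2) / 4 := by
  obtain ⟨hl₀, hl₁⟩ := hl
  have hpos : 0 < b - a := sub_pos.2 hab
  obtain ⟨p, hp⟩ : ∃ p, p = a + l * (b - a) / 2 := ⟨_, rfl⟩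
  obtain ⟨q, hq⟩ : ∃ q, q = b - l * (b - a) / 2 := ⟨_, rfl⟩
  obtain ⟨m, hm⟩ : ∃ m, m = (a + b) / 2 := ⟨_, rfl⟩
  have hap : a ≤ p := by nlinarith
  have hpm : p ≤ m := by nlinarith
  have hmq : m ≤ q := by nlinarith
  have hqb : q ≤ b := by nlinarith
  have hsub : ∀ {u v c : ℝ}, a ≤ u → u ≤ c → c ≤ v → v ≤ b →
      |(∫ s in u..v, f s) - f c * (v - u)| ≤ M * ((c - u) ^ 2 + (v - c) ^ 2) / 2 :=
    fun hau huc hcv hvb => abs_integral_sub_mul_le huc hcv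
      (hcont.mono (Set.Icc_subset_Icc hau hvb)) fun _ hs =>
        abs_sub_le_of_abs_hasDerivAt_le hcont hderiv hbound
          (Set.Icc_subset_Icc hau hvb hs) ⟨hau.trans huc, hcv.trans hvb⟩
  have hint : ∀ {u v : ℝ}, a ≤ u → u ≤ v → v ≤ b →
      IntervalIntegrable f MeasureTheory.volume u v :=
    fun hau huv hvb => (hcont.mono (Set.Icc_subset_Icc hau hvb)).intervalIntegrable_of_Icc huv
  have hpq : p ≤ q := hpm.trans hmq
  have hsum : (∫ s in a..p, f s) + (∫ s in p..q, f s) + (∫ s in q..b, f s) =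
      ∫ s in a..b, f s := by
    rw [intervalIntegral.integral_add_adjacent_intervals
        (hint le_rfl hap (hpq.trans hqb)) (hint hap hpq hqb),
      intervalIntegral.integral_add_adjacent_intervals
        (hint le_rfl (hap.trans hpq) hqb) (hint (hap.trans hpq) hqb le_rfl)]
  have h₁ := abs_le.1 (hsub le_rfl le_rfl hap (hpq.trans hqb))
  have h₂ := abs_le.1 (hsub hap hpm hmq hqb)
  have h₃ := abs_le.1 (hsub (hap.trans hpq) hqb le_rfl le_rfl)
  have herr : |((1 - l) * f m + l * (f a + f b) / 2) * (b - a) - ∫ s in a..b, f s| ≤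
      M * (b - a) * ((1 - l) ^ 2 + l ^ 2) / 4 * (b - a) := by
    rw [← hsum, abs_le]
    subst hp hq hm
    constructor <;> linarith [h₁.1, h₁.2, h₂.1, h₂.2, h₃.1, h₃.2]
  have hscale : (1 - l) * f m + l * (f a + f b) / 2 - (1 / (b - a)) * ∫ s in a..b, f s =
      (((1 - l) * f m + l * (f a + f b) / 2) * (b - a) - ∫ s in a..b, f s) / (b - a) := by
    field_simp
  rw [← hm, hscale, abs_div, abs_of_pos hpos]
  exact (div_le_iff₀ hpos).2 herr
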